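/- Let k be a perfect field, let f, g ∈ k[x] be monic irreducible polynomials with f(0) ≠ 0 ≠ g(0), and let s, t be positive integers. Suppose k[x]/(x−1)^s ⊗ k[x]/(x−1)^t ≅ ⊕_{i=1}^n k[x]/(x−1)^{m_i} for positive integers m_1, …, m_n and k[x]/f ⊗ k[x]/g ≅ ⊕_{j=1}^{n'} k[x]/h_j for monic irreducible polynomials h_1, …, h_{n'} ∈ k[x] with nonzero constant terms. Then k[x]/f^s ⊗ k[x]/g^t ≅ ⊕_{i=1}^n ⊕_{j=1}^{n'} k[x]/h_j^{m_i} as k[x]-modules. -/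

import Mathlib

open Polynomial TensorProduct

/-- The `k`-linear operator on the `k[x]`-module `k[x]/(h)` given by the action of `x`,
i.e. multiplication by `x`. -/
noncomputable def mulXop (k : Type*) [Field k] (h : k[X]) :
    (k[X] ⧸ Ideal.span {h}) →ₗ[k] (k[X] ⧸ Ideal.span {h}) :=
  LinearMap.mulLeft k (Ideal.Quotient.mk (Ideal.span {h}) X)

/-- Two `k[x]`-modules, presented as vector spaces equipped with the `k`-linear operator
by which `x` acts, are isomorphic iff there is a `k`-linear equivalence intertwining the
two operators. -/
def OpIso {k V W : Type*} [Field k] [AddCommGroup V] [Module k V]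
    [AddCommGroup W] [Module k W] (f : V →ₗ[k] V) (g : W →ₗ[k] W) : Prop :=
  ∃ e : V ≃ₗ[k] W, ∀ v, e (f v) = g (e v)

/-- The direct sum of a family of operators, as an operator on the direct sum
(product) of the underlying spaces. -/
def piOp {k : Type*} [Field k] {ι : Type*} {V : ι → Type*} [∀ i, AddCommGroup (V i)]
    [∀ i, Module k (V i)] (f : ∀ i, V i →ₗ[k] V i) : (∀ i, V i) →ₗ[k] (∀ i, V i) :=
  LinearMap.pi fun i => (f i).comp (LinearMap.proj i)


namespace Stmt8Aux

section basics

variable {k : Type*} [Field k]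

theorem opIso_symm {V W : Type*} [AddCommGroup V] [Module k V] [AddCommGroup W] [Module k W]
    {f : V →ₗ[k] V} {g : W →ₗ[k] W} (h : OpIso f g) : OpIso g f := by
  obtain ⟨e, he⟩ := h
  refine ⟨e.symm, fun v => ?_⟩
  rw [LinearEquiv.symm_apply_eq, he, LinearEquiv.apply_symm_apply]

theorem opIso_trans {U V W : Type*} [AddCommGroup U] [Module k U] [AddCommGroup V] [Module k V]
    [AddCommGroup W] [Module k W] {e : U →ₗ[k] U}
    {f : V →ₗ[k] V} {g : W →ₗ[k] W} (h : OpIso e f) (h' : OpIso f g) : OpIso e g := by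
  obtain ⟨a, ha⟩ := h
  obtain ⟨b, hb⟩ := h'
  exact ⟨a.trans b, fun v => by simp [ha, hb]⟩

theorem opIso_of_comp {V W : Type*} [AddCommGroup V] [Module k V] [AddCommGroup W] [Module k W]
    {f : V →ₗ[k] V} {g : W →ₗ[k] W} (e : V ≃ₗ[k] W)
    (he : e.toLinearMap ∘ₗ f = g ∘ₗ e.toLinearMap) : OpIso f g :=
  ⟨e, fun v => LinearMap.congr_fun he v⟩

theorem opIso_map {V W V' W' : Type*} [AddCommGroup V] [Module k V] [AddCommGroup W] [Module k W]
    [AddCommGroup V'] [Module k V'] [AddCommGroup W'] [Module k W']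
    {f : V →ₗ[k] V} {g : W →ₗ[k] W} {f' : V' →ₗ[k] V'} {g' : W' →ₗ[k] W'}
    (h : OpIso f g) (h' : OpIso f' g') :
    OpIso (TensorProduct.map f f') (TensorProduct.map g g') := by
  obtain ⟨a, ha⟩ := h
  obtain ⟨b, hb⟩ := h'
  refine opIso_of_comp (TensorProduct.congr a b) ?_
  ext x y
  simp [ha, hb]

theorem opIso_comm {V W : Type*} [AddCommGroup V] [Module k V] [AddCommGroup W] [Module k W]
    (f : V →ₗ[k] V) (g : W →ₗ[k] W) :
    OpIso (TensorProduct.map f g) (TensorProduct.map g f) := by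
  refine opIso_of_comp (TensorProduct.comm k V W) ?_
  ext x y
  simp

theorem opIso_tttc {V W V' W' : Type*} [AddCommGroup V] [Module k V] [AddCommGroup W] [Module k W]
    [AddCommGroup V'] [Module k V'] [AddCommGroup W'] [Module k W']
    (f : V →ₗ[k] V) (g : W →ₗ[k] W) (f' : V' →ₗ[k] V') (g' : W' →ₗ[k] W') :
    OpIso (TensorProduct.map (TensorProduct.map f g) (TensorProduct.map f' g'))
      (TensorProduct.map (TensorProduct.map f f') (TensorProduct.map g g')) := by
  refine opIso_of_comp (TensorProduct.tensorTensorTensorComm k V W V' W') ?_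
  ext x y z w
  simp

theorem opIso_pi {ι : Type*} {V W : ι → Type*} [∀ i, AddCommGroup (V i)] [∀ i, Module k (V i)]
    [∀ i, AddCommGroup (W i)] [∀ i, Module k (W i)]
    {f : ∀ i, V i →ₗ[k] V i} {g : ∀ i, W i →ₗ[k] W i} (h : ∀ i, OpIso (f i) (g i)) :
    OpIso (piOp f) (piOp g) := by
  choose e he using h
  refine ⟨LinearEquiv.piCongrRight e, fun v => ?_⟩
  ext i
  simp [piOp, he]

theorem opIso_piRight {ι : Type*} [Finite ι] {U : Type*} [AddCommGroup U] [Module k U]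
    {V : ι → Type*} [∀ i, AddCommGroup (V i)] [∀ i, Module k (V i)]
    (a : U →ₗ[k] U) (f : ∀ i, V i →ₗ[k] V i) :
    OpIso (TensorProduct.map a (piOp f)) (piOp fun i => TensorProduct.map a (f i)) := by
  classical
  have := Fintype.ofFinite ι
  refine opIso_of_comp (TensorProduct.piRight k k U V) ?_
  apply TensorProduct.ext'
  intro x y
  ext i
  simp [piOp]

theorem opIso_curry {ι κ : Type*} {V : ι → κ → Type*} [∀ i j, AddCommGroup (V i j)]
    [∀ i j, Module k (V i j)] (f : ∀ i j, V i j →ₗ[k] V i j) :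
    OpIso (piOp fun i => piOp (f i)) (piOp fun q : ι × κ => f q.1 q.2) := by
  refine ⟨{ toFun := fun v q => v q.1 q.2
            invFun := fun v i j => v (i, j)
            map_add' := fun _ _ => rfl
            map_smul' := fun _ _ => rfl
            left_inv := fun _ => rfl
            right_inv := fun _ => rfl }, fun v => rfl⟩

end basics

section key

variable {k : Type*} [Field k]

theorem exists_root (f : k[X]) (hf : Irreducible f) (hsep : f.Separable) (hf0 : f.eval 0 ≠ 0)
    (s : ℕ) : ∃ a b : k[X] ⧸ Ideal.span {f ^ s}, aeval a f = 0 ∧ a * b = 1 ∧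
      (Ideal.Quotient.mk (Ideal.span {f ^ s}) X - a) ^ s = 0 := by
  set x := Ideal.Quotient.mk (Ideal.span {f ^ s}) X with hx
  have hae : ∀ p : k[X], aeval x p = Ideal.Quotient.mk (Ideal.span {f ^ s}) p := by
    intro p
    have := aeval_algHom_apply (Ideal.Quotient.mkₐ k (Ideal.span {f ^ s})) X p
    simpa using this
  have hnil : IsNilpotent (aeval x f) := by
    refine ⟨s, ?_⟩
    rw [hae, ← map_pow, Ideal.Quotient.eq_zero_iff_mem]
    exact Ideal.mem_span_singleton_self _
  have hunit : IsUnit (aeval x (derivative f)) := by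
    obtain ⟨a, b, hab⟩ := hsep
    have h1 : aeval x b * aeval x (derivative f) = 1 - aeval x a * aeval x f := by
      rw [eq_sub_iff_add_eq', ← map_mul, ← map_mul, ← map_add, hab, map_one]
    have h2 : IsUnit (aeval x b * aeval x (derivative f)) := by
      rw [h1]
      exact ((Commute.all _ _).isNilpotent_mul_left hnil).isUnit_one_sub
    exact isUnit_of_mul_isUnit_right h2
  obtain ⟨a, ⟨ha1, ha2⟩, -⟩ := existsUnique_nilpotent_sub_and_aeval_eq_zero hnil hunit
  have hau : IsUnit a := by
    have h3 : a * aeval a f.divX = - algebraMap k _ (f.eval 0) := by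
      have h4 := congrArg (aeval a) (X_mul_divX_add f)
      rw [ha2, map_add, map_mul, aeval_X, aeval_C, coeff_zero_eq_eval_zero] at h4
      exact eq_neg_of_add_eq_zero_left h4
    have h5 : IsUnit (a * aeval a f.divX) := by
      rw [h3]
      exact ((isUnit_iff_ne_zero.mpr hf0).map (algebraMap k (k[X] ⧸ Ideal.span {f ^ s}))).neg
    exact isUnit_of_mul_isUnit_left h5
  obtain ⟨b, hb⟩ := hau.exists_right_inv
  refine ⟨a, b, ha2, hb, ?_⟩
  obtain ⟨N, hN⟩ := ha1
  obtain ⟨p, hp⟩ := Ideal.Quotient.mk_surjective (x - a)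
  rw [← hp] at hN ⊢
  rw [← map_pow, Ideal.Quotient.eq_zero_iff_mem, Ideal.mem_span_singleton] at hN ⊢
  rcases Nat.eq_zero_or_pos s with rfl | hs
  · simp
  · exact pow_dvd_pow_of_dvd (hf.prime.dvd_of_dvd_pow ((dvd_pow_self f hs.ne').trans hN)) s

theorem key [PerfectField k] (f : k[X]) (hfm : f.Monic) (hf : Irreducible f)
    (hf0 : f.eval 0 ≠ 0) (s : ℕ) :
    OpIso (TensorProduct.map (mulXop k f) (mulXop k ((X - 1) ^ s))) (mulXop k (f ^ s)) := by
  obtain ⟨a, b, ha, hab, hs⟩ :=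
    exists_root f hf (PerfectField.separable_of_irreducible hf) hf0 s
  set x := Ideal.Quotient.mk (Ideal.span {f ^ s}) X with hx
  let φ : (k[X] ⧸ Ideal.span {f}) →ₐ[k] (k[X] ⧸ Ideal.span {f ^ s}) :=
    Ideal.Quotient.liftₐ _ (aeval a) (by
      intro p hp
      obtain ⟨q, rfl⟩ := Ideal.mem_span_singleton.mp hp
      rw [map_mul, ha, zero_mul])
  let ψ : (k[X] ⧸ Ideal.span {((X : k[X]) - 1) ^ s}) →ₐ[k] (k[X] ⧸ Ideal.span {f ^ s}) :=
    Ideal.Quotient.liftₐ _ (aeval (x * b)) (by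
      intro p hp
      obtain ⟨q, rfl⟩ := Ideal.mem_span_singleton.mp hp
      have : x * b - 1 = (x - a) * b := by rw [sub_mul, hab]
      rw [map_mul, map_pow, map_sub, aeval_X, map_one, this, mul_pow, hs, zero_mul, zero_mul])
  have hφ : φ (Ideal.Quotient.mk _ X) = a := by
    change aeval a X = a
    simp
  have hψ : ψ (Ideal.Quotient.mk _ X) = x * b := by
    change aeval (x * b) X = x * b
    simp
  let Φ := Algebra.TensorProduct.productMap φ ψ
  have hΦ : Φ (Ideal.Quotient.mk _ X ⊗ₜ Ideal.Quotient.mk _ X) = x := by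
    rw [Algebra.TensorProduct.productMap_apply_tmul, hφ, hψ, mul_left_comm, hab, mul_one]
  have hsurj : Function.Surjective Φ := by
    intro y
    obtain ⟨p, rfl⟩ := Ideal.Quotient.mk_surjective y
    refine ⟨aeval (Ideal.Quotient.mk _ X ⊗ₜ Ideal.Quotient.mk _ X) p, ?_⟩
    rw [← aeval_algHom_apply, hΦ]
    have := aeval_algHom_apply (Ideal.Quotient.mkₐ k (Ideal.span {f ^ s})) X p
    simpa using this
  have hX : ((X : k[X]) - 1).Monic := monic_X_sub_C 1
  have hXd : ((X : k[X]) - 1).natDegree = 1 := natDegree_X_sub_C 1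
  have : Module.Finite k (k[X] ⧸ Ideal.span {f}) := hfm.finite_quotient
  have : Module.Finite k (k[X] ⧸ Ideal.span {((X : k[X]) - 1) ^ s}) := (hX.pow s).finite_quotient
  have : Module.Finite k (k[X] ⧸ Ideal.span {f ^ s}) := (hfm.pow s).finite_quotient
  have hrank : Module.finrank k
      ((k[X] ⧸ Ideal.span {f}) ⊗[k] (k[X] ⧸ Ideal.span {((X : k[X]) - 1) ^ s})) =
      Module.finrank k (k[X] ⧸ Ideal.span {f ^ s}) := by
    rw [Module.finrank_tensorProduct, finrank_quotient_span_eq_natDegree,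
      finrank_quotient_span_eq_natDegree, finrank_quotient_span_eq_natDegree,
      natDegree_pow, natDegree_pow, hXd, mul_one, mul_comm]
  have hinj : Function.Injective Φ.toLinearMap :=
    (LinearMap.injective_iff_surjective_of_finrank_eq_finrank hrank).mpr hsurj
  refine ⟨LinearEquiv.ofBijective Φ.toLinearMap ⟨hinj, hsurj⟩, fun v => ?_⟩
  change Φ _ = x * Φ v
  rw [← hΦ, ← map_mul]
  congr 1
  induction v with
  | zero => simp
  | add v w hv hw => rw [map_add, mul_add, hv, hw]
  | tmul v w => simp [mulXop]

end key

end Stmt8Aux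


theorem stmt8 {k : Type*} [Field k] [PerfectField k] (f g : k[X])
    (hfm : f.Monic) (hgm : g.Monic) (hf : Irreducible f) (hg : Irreducible g)
    (hf0 : f.eval 0 ≠ 0) (hg0 : g.eval 0 ≠ 0) (s t : ℕ) (hs : 0 < s) (ht : 0 < t)
    (n n' : ℕ) (m : Fin n → ℕ) (hm : ∀ i, 0 < m i)
    (h : Fin n' → k[X]) (hh : ∀ j, (h j).Monic ∧ Irreducible (h j) ∧ (h j).eval 0 ≠ 0)
    (h1 : OpIso (TensorProduct.map (mulXop k ((X - 1) ^ s)) (mulXop k ((X - 1) ^ t)))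
      (piOp fun i => mulXop k ((X - 1) ^ m i)))
    (h2 : OpIso (TensorProduct.map (mulXop k f) (mulXop k g)) (piOp fun j => mulXop k (h j))) :
    OpIso (TensorProduct.map (mulXop k (f ^ s)) (mulXop k (g ^ t)))
      (piOp fun q : Fin n × Fin n' => mulXop k (h q.2 ^ m q.1)) := by
  have e1 := Stmt8Aux.opIso_map (Stmt8Aux.opIso_symm (Stmt8Aux.key f hfm hf hf0 s))
    (Stmt8Aux.opIso_symm (Stmt8Aux.key g hgm hg hg0 t))
  refine Stmt8Aux.opIso_trans e1 ?_
  refine Stmt8Aux.opIso_trans (Stmt8Aux.opIso_tttc _ _ _ _) ?_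
  refine Stmt8Aux.opIso_trans (Stmt8Aux.opIso_map h2 h1) ?_
  refine Stmt8Aux.opIso_trans (Stmt8Aux.opIso_piRight _ _) ?_
  refine Stmt8Aux.opIso_trans (Stmt8Aux.opIso_pi fun i => ?_)
    (Stmt8Aux.opIso_curry fun i j => mulXop k (h j ^ m i))
  refine Stmt8Aux.opIso_trans (Stmt8Aux.opIso_comm _ _) ?_
  refine Stmt8Aux.opIso_trans (Stmt8Aux.opIso_piRight _ _) ?_
  refine Stmt8Aux.opIso_pi fun j => ?_
  refine Stmt8Aux.opIso_trans (Stmt8Aux.opIso_comm _ _) ?_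
  exact Stmt8Aux.key (h j) (hh j).1 (hh j).2.1 (hh j).2.2 (m i)
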